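/- For every C¹ function ψ : S¹ → ℝ and every n ∈ ℕ, the function Lⁿψ is C¹ and ‖Lⁿψ‖_{C¹} ≤ (1 + Ω)²·‖ψ‖_{C¹}, where ‖u‖_{C¹} = ‖u‖_∞ + ‖u'‖_∞. In particular the pointwise bound |(Lⁿψ)'| ≤ λ⁻ⁿ·Lⁿ|ψ'| + ‖T''‖_∞·(Σ_{i=2}^{n+1} λ⁻ⁱ)·Lⁿ|ψ| holds for every n ≥ 1. -/

import Mathlib

open MeasureTheory Real

theorem aux_int (F : ℝ → ℝ) (w : ℕ) (hFw : ∀ x : ℝ, F (x + 1) = F x + w) (x : ℝ) (k : ℤ) :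
    F (x + k) = F x + k * w := by
  have hp : Function.Periodic (fun x => F x - w * x) 1 := by
    intro x
    simp only [hFw]; ring
  have := hp.int_mul k x
  simp only [mul_one] at this
  linarith

theorem aux_inv (F : ℝ → ℝ) (hF : ContDiff ℝ 2 F)
    (w : ℕ) (hw : 0 < w) (hFw : ∀ x : ℝ, F (x + 1) = F x + w)
    (lam : ℝ) (hlam : 1 < lam) (hexp : ∀ x : ℝ, lam ≤ deriv F x) :
    ∃ G : ℝ → ℝ, (∀ x, F (G x) = x) ∧ (∀ x, G (F x) = x) ∧
      (∀ x, HasDerivAt G (1 / deriv F (G x)) x) ∧ (∀ x (k : ℤ), G (x + k * w) = G x + k) := by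
  have hd : ∀ x, HasDerivAt F (deriv F x) x := fun x =>
    (hF.differentiable (by norm_num) x).hasDerivAt
  have hpos : ∀ x, 0 < deriv F x := fun x => by linarith [hexp x]
  have hm : StrictMono F := strictMono_of_deriv_pos hpos
  have hs : Function.Surjective F := by
    intro y
    have hw' : (0:ℝ) < w := by exact_mod_cast hw
    obtain ⟨k, hk⟩ := exists_int_gt ((y - F 0) / w)
    obtain ⟨l, hl⟩ := exists_int_lt ((y - F 0) / w)
    rw [div_lt_iff₀ hw'] at hk
    rw [lt_div_iff₀ hw'] at hl
    have h1 := aux_int F w hFw 0 k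
    have h2 := aux_int F w hFw 0 l
    exact mem_range_of_exists_le_of_exists_ge hF.continuous
      ⟨0 + l, by linarith⟩ ⟨0 + k, by linarith⟩
  let e := hm.orderIsoOfSurjective F hs
  have he : ∀ x, e x = F x := fun x => rfl
  have h1 : ∀ x, F (e.symm x) = x := fun x => e.apply_symm_apply x
  have h2 : ∀ x, e.symm (F x) = x := fun x => e.symm_apply_apply x
  refine ⟨e.symm, h1, h2, ?_, ?_⟩
  · intro x
    rw [one_div]
    exact HasDerivAt.of_local_left_inverse e.symm.continuous.continuousAt (hd _) (hpos _).ne'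
      (Filter.Eventually.of_forall h1)
  · intro x k
    apply hm.injective
    rw [h1, aux_int F w hFw, h1]

theorem aux_coe (x y : ℝ) : (x : UnitAddCircle) = y ↔ ∃ k : ℤ, x = y + k := by
  rw [← sub_eq_zero, ← AddCircle.coe_sub, AddCircle.coe_eq_zero_iff]
  constructor
  · rintro ⟨k, hk⟩
    exact ⟨k, by simp at hk; linarith⟩
  · rintro ⟨k, hk⟩
    exact ⟨k, by simp; linarith⟩

theorem aux_sum (F : ℝ → ℝ) (w : ℕ) (hw : 0 < w)
    (T : UnitAddCircle → UnitAddCircle) (hT : ∀ x : ℝ, T ↑x = (↑(F x) : UnitAddCircle))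
    (G : ℝ → ℝ) (h1 : ∀ x, F (G x) = x) (h2 : ∀ x, G (F x) = x)
    (h3 : ∀ x (k : ℤ), G (x + k * w) = G x + k) (f : UnitAddCircle → ℝ) (x : ℝ) :
    ∑' y : (T ⁻¹' {(x : UnitAddCircle)}), f y = ∑ j ∈ Finset.range w, f ↑(G (x + j)) := by
  have hm : ∀ j : Fin w, ((G (x + (j:ℕ)) : ℝ) : UnitAddCircle) ∈ T ⁻¹' {(x : UnitAddCircle)} := by
    intro j
    simp only [Set.mem_preimage, Set.mem_singleton_iff, hT, h1]
    rw [aux_coe]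
    exact ⟨(j : ℕ), by simp⟩
  have hb : Function.Bijective
      (fun j : Fin w => (⟨_, hm j⟩ : (T ⁻¹' {(x : UnitAddCircle)}))) := by
    constructor
    · intro i j hij
      have := congrArg Subtype.val hij
      simp only at this
      rw [aux_coe] at this
      obtain ⟨k, hk⟩ := this
      rw [← h3] at hk
      have h4 := congrArg F hk
      rw [h1, h1] at h4
      have h5 : (((i:ℕ):ℤ):ℝ) = (((j:ℕ):ℤ) + k * (w:ℤ) : ℤ) := by push_cast; linarith
      have h6 : ((i:ℕ):ℤ) = ((j:ℕ):ℤ) + k * (w:ℤ) := by exact_mod_cast h5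
      have hi := i.2
      have hj := j.2
      have hk0 : k = 0 := by
        have a1 : k < 1 := by
          by_contra hc
          have : 1 * (w:ℤ) ≤ k * w := mul_le_mul_of_nonneg_right (by omega) (by omega)
          omega
        have a2 : -1 < k := by
          by_contra hc
          have : k * (w:ℤ) ≤ (-1) * w := mul_le_mul_of_nonneg_right (by omega) (by omega)
          omega
        omega
      subst hk0
      apply Fin.ext
      omega
    · rintro ⟨y, hy⟩
      induction y using QuotientAddGroup.induction_on with | H t => ?_
      have hy' : T (t : UnitAddCircle) = x := hy
      rw [hT, aux_coe] at hy'
      obtain ⟨m, hm'⟩ := hy'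
      have hw' : (0:ℤ) < w := by exact_mod_cast hw
      refine ⟨⟨(m % w).toNat, by have := Int.emod_lt_of_pos m hw'; omega⟩, ?_⟩
      apply Subtype.ext
      change ((G (x + ((m % w).toNat : ℕ)) : ℝ) : UnitAddCircle) = (t : UnitAddCircle)
      symm
      rw [aux_coe]
      refine ⟨m / w, ?_⟩
      rw [← h3, ← h2 t, hm']
      congr 1
      have e1 : (((m % w).toNat : ℕ) : ℤ) = m % w := Int.toNat_of_nonneg (Int.emod_nonneg _ hw'.ne')
      have e2 : m = (((m % w).toNat : ℕ) : ℤ) + (m / w) * w := by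
        rw [e1]; have := Int.emod_add_mul_ediv m w; linarith
      have e3 : (m:ℝ) = ((((m % w).toNat : ℕ) : ℤ) + (m / w) * w : ℤ) := by exact_mod_cast e2
      push_cast at e3
      linarith
  rw [← (Equiv.ofBijective _ hb).tsum_eq, tsum_fintype]
  exact Fin.sum_univ_eq_sum_range (fun j => f ↑(G (x + (j:ℕ)))) w

theorem aux_step (F : ℝ → ℝ) (hF : ContDiff ℝ 2 F) (w : ℕ)
    (lam : ℝ) (hlam : 1 < lam) (hexp : ∀ x : ℝ, lam ≤ deriv F x)
    (M : ℝ) (hM : ∀ x, |deriv (deriv F) x| ≤ M)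
    (G : ℝ → ℝ) (hG : ∀ x, HasDerivAt G (1 / deriv F (G x)) x)
    (v : ℝ → ℝ) (hv : ContDiff ℝ 1 v) :
    ContDiff ℝ 1 (fun x => ∑ j ∈ Finset.range w, v (G (x + j)) / deriv F (G (x + j))) ∧
    ∀ x, |deriv (fun x => ∑ j ∈ Finset.range w, v (G (x + j)) / deriv F (G (x + j))) x| ≤
      1 / lam * (∑ j ∈ Finset.range w, |deriv v (G (x + j))| / deriv F (G (x + j))) +
      M / lam ^ 2 * (∑ j ∈ Finset.range w, |v (G (x + j))| / deriv F (G (x + j))) := by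
  have hpos : ∀ x, 0 < deriv F x := fun x => by linarith [hexp x]
  have hF1 : ContDiff ℝ 1 (deriv F) := by
    have : ContDiff ℝ (1 + 1) F := by norm_num; exact hF
    exact (contDiff_succ_iff_deriv.1 this).2.2
  have hF2 := contDiff_one_iff_deriv.1 hF1
  have hv2 := contDiff_one_iff_deriv.1 hv
  have hGc : Continuous G := continuous_iff_continuousAt.2 fun x => (hG x).continuousAt
  let q' : ℝ → ℝ := fun y => (deriv v y * deriv F y - v y * deriv (deriv F) y) / (deriv F y) ^ 2
  have hq : ∀ y, HasDerivAt (fun y => v y / deriv F y) (q' y) y := fun y =>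
    (hv2.1 y).hasDerivAt.div (hF2.1 y).hasDerivAt (hpos y).ne'
  have hq'c : Continuous q' := by
    refine Continuous.div ?_ ?_ (fun y => (pow_pos (hpos y) 2).ne')
    · exact (hv2.2.mul hF1.continuous).sub (hv.continuous.mul hF2.2)
    · exact hF1.continuous.pow 2
  have hterm : ∀ (j : ℕ) (x : ℝ), HasDerivAt (fun x => v (G (x + j)) / deriv F (G (x + j)))
      (q' (G (x + j)) * (1 / deriv F (G (x + j)))) x := by
    intro j x
    have a := ((hG (x + j)).comp_add_const x (j:ℝ))
    exact (hq (G (x + j))).comp x a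
  have hsum : ∀ x, HasDerivAt (fun x => ∑ j ∈ Finset.range w, v (G (x + j)) / deriv F (G (x + j)))
      (∑ j ∈ Finset.range w, q' (G (x + j)) * (1 / deriv F (G (x + j)))) x := by
    intro x
    exact HasDerivAt.fun_sum fun j _ => hterm j x
  constructor
  · rw [contDiff_one_iff_deriv]
    refine ⟨fun x => (hsum x).differentiableAt, ?_⟩
    rw [funext fun x => (hsum x).deriv]
    refine continuous_finsetSum _ fun j _ => ?_
    have hGj : Continuous fun x : ℝ => G (x + j) := hGc.comp (by fun_prop)
    refine (hq'c.comp hGj).mul (continuous_const.div (hF1.continuous.comp hGj) fun x => (hpos _).ne')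
  · intro x
    rw [(hsum x).deriv, Finset.mul_sum, Finset.mul_sum, ← Finset.sum_add_distrib]
    refine (Finset.abs_sum_le_sum_abs _ _).trans (Finset.sum_le_sum fun j _ => ?_)
    set y := G (x + j)
    have hp := hpos y
    have hl := hexp y
    have hl0 : 0 < lam := by linarith
    have hq1 : |q' y| ≤ 1 / lam * |deriv v y| + M / lam ^ 2 * |v y| := by
      have e : q' y = deriv v y * (1 / deriv F y) - v y * deriv (deriv F) y * (1 / (deriv F y) ^ 2) := by
        simp only [q']; field_simp
      rw [e]
      refine (abs_sub _ _).trans (add_le_add ?_ ?_)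
      · rw [abs_mul, abs_of_pos (one_div_pos.2 hp), mul_comm]
        gcongr
      · rw [abs_mul, abs_mul, abs_of_pos (one_div_pos.2 (pow_pos hp 2))]
        have := hM y
        calc |v y| * |deriv (deriv F) y| * (1 / deriv F y ^ 2) ≤ |v y| * M * (1 / lam ^ 2) := by
              gcongr
              have := abs_nonneg (deriv (deriv F) y); nlinarith [abs_nonneg (v y)]
          _ = _ := by ring
    rw [abs_mul, abs_of_pos (one_div_pos.2 hp)]
    calc _ ≤ (1 / lam * |deriv v y| + M / lam ^ 2 * |v y|) * (1 / deriv F y) := by gcongr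
      _ = _ := by ring

theorem aux_integral (F : ℝ → ℝ) (hF : ContDiff ℝ 2 F) (w : ℕ)
    (lam : ℝ) (hlam : 1 < lam) (hexp : ∀ x : ℝ, lam ≤ deriv F x)
    (G : ℝ → ℝ) (hG : ∀ x, HasDerivAt G (1 / deriv F (G x)) x)
    (h3 : ∀ x (k : ℤ), G (x + k * w) = G x + k)
    (v : ℝ → ℝ) (hv : Continuous v) (hvp : Function.Periodic v 1) :
    ∫ x in (0:ℝ)..1, (∑ j ∈ Finset.range w, v (G (x + j)) / deriv F (G (x + j))) =
      ∫ x in (0:ℝ)..1, v x := by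
  have hpos : ∀ x, 0 < deriv F x := fun x => by linarith [hexp x]
  have hGc : Continuous G := continuous_iff_continuousAt.2 fun x => (hG x).continuousAt
  have hF1 : Continuous (deriv F) := hF.continuous_deriv (by norm_num)
  have hD : Continuous fun x => 1 / deriv F (G x) :=
    continuous_const.div (hF1.comp hGc) fun x => (hpos _).ne'
  let f : ℝ → ℝ := fun x => v (G x) / deriv F (G x)
  have hf : Continuous f := (hv.comp hGc).div (hF1.comp hGc) fun x => (hpos _).ne'
  have e1 : ∫ x in (0:ℝ)..1, (∑ j ∈ Finset.range w, v (G (x + j)) / deriv F (G (x + j))) =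
      ∑ j ∈ Finset.range w, ∫ x in (0:ℝ)..1, f (x + j) := by
    rw [← intervalIntegral.integral_finsetSum]
    intro j _
    exact Continuous.intervalIntegrable (hf.comp (by fun_prop)) _ _
  have e2 : ∀ j ∈ Finset.range w, ∫ x in (0:ℝ)..1, f (x + j) = ∫ x in (j:ℝ)..((j+1:ℕ):ℝ), f x := by
    intro j _
    rw [intervalIntegral.integral_comp_add_right]
    congr 1
    · simp
    · push_cast; ring
  rw [e1, Finset.sum_congr rfl e2, intervalIntegral.sum_integral_adjacent_intervals
    (a := fun j : ℕ => (j:ℝ)) (fun k _ => hf.intervalIntegrable _ _)]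
  have e3 := intervalIntegral.integral_comp_mul_deriv (a := ((0:ℕ):ℝ)) (b := (w:ℝ)) (f := G)
    (f' := fun x => 1 / deriv F (G x)) (g := v) (fun x _ => hG x) hD.continuousOn hv
  have e4 : G w = G ((0:ℕ):ℝ) + 1 := by simpa using h3 0 1
  have e5 : f = fun x => (v ∘ G) x * (1 / deriv F (G x)) := by
    ext x; simp [f, div_eq_mul_inv]
  rw [e5, e3, e4, hvp.intervalIntegral_add_eq _ 0, zero_add]

theorem aux_sup (h : ℝ → ℝ) (hh : ContDiff ℝ 1 h) (hp : Function.Periodic h 1)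
    (hi : ∫ x in (0:ℝ)..1, h x = 1) (C : ℝ) (hC : ∀ x, |deriv h x| ≤ C * h x) (x : ℝ) :
    h x ≤ 1 + C := by
  have h2 := contDiff_one_iff_deriv.1 hh
  have hi' : ∫ y in (x-1)..x, h y = 1 := by
    have := hp.intervalIntegral_add_eq (x-1) 0
    simp only [sub_add_cancel, zero_add] at this
    rw [this, hi]
  have key : ∀ y ∈ Set.Icc (x-1) x, h x - C ≤ h y := by
    intro y hy
    have e1 : ∫ t in y..x, deriv h t = h x - h y :=
      intervalIntegral.integral_eq_sub_of_hasDerivAt (fun t _ => (h2.1 t).hasDerivAt)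
        (h2.2.intervalIntegrable _ _)
    have e2 : ∫ t in y..x, deriv h t ≤ ∫ t in y..x, C * h t :=
      intervalIntegral.integral_mono_on hy.2 (h2.2.intervalIntegrable _ _)
        ((continuous_const.mul hh.continuous).intervalIntegrable _ _)
        (fun t _ => (le_abs_self _).trans (hC t))
    have e3 : ∫ t in y..x, C * h t ≤ ∫ t in (x-1)..x, C * h t := by
      have a := intervalIntegral.integral_add_adjacent_intervals
        (Continuous.intervalIntegrable (continuous_const.mul hh.continuous : Continuous fun t => C * h t) (μ := volume) (x-1) y)
        (Continuous.intervalIntegrable (continuous_const.mul hh.continuous : Continuous fun t => C * h t) (μ := volume) y x)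
      simp only [Pi.mul_apply] at a
      have b : 0 ≤ ∫ t in (x-1)..y, C * h t :=
        intervalIntegral.integral_nonneg hy.1 fun t _ => (abs_nonneg _).trans (hC t)
      linarith
    rw [intervalIntegral.integral_const_mul, intervalIntegral.integral_const_mul, hi'] at e3
    rw [intervalIntegral.integral_const_mul] at e2
    linarith
  have := intervalIntegral.integral_mono_on (μ := volume) (a := x-1) (b := x) (by linarith)
    (continuous_const.intervalIntegrable _ _) (hh.continuous.intervalIntegrable _ _) key
  rw [hi'] at this
  simp at this
  linarith

theorem aux_bdd (u : UnitAddCircle → ℝ) (hu : Continuous fun x : ℝ => u x) :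
    BddAbove (Set.range fun z => |u z|) := by
  have hp : Function.Periodic (fun x : ℝ => |u x|) 1 := fun x => by
    simp only [AddCircle.coe_add_period]
  have hc := (hp.compact_of_continuous one_ne_zero hu.abs).bddAbove
  refine hc.mono ?_
  rintro _ ⟨z, rfl⟩
  induction z using QuotientAddGroup.induction_on with | H t => exact ⟨t, rfl⟩

theorem aux_geom (lam : ℝ) (hl0 : 0 < lam) (n : ℕ) :
    ∑ i ∈ Finset.Icc 2 (n + 1 + 1), (1 / lam ^ i) =
          1 / lam * ∑ i ∈ Finset.Icc 2 (n + 1), (1 / lam ^ i) + 1 / lam ^ 2 := by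
  induction n with
  | zero => simp
  | succ n ih =>
    have e1 := Finset.sum_Icc_succ_top (a := 2) (b := n + 1 + 1) (by omega) (fun i => 1 / lam ^ i)
    have e2 := Finset.sum_Icc_succ_top (a := 2) (b := n + 1) (by omega) (fun i => 1 / lam ^ i)
    rw [e1]
    rw [e2] at ih ⊢
    rw [mul_add]
    set S := ∑ k ∈ Finset.Icc 2 (n + 1), 1 / lam ^ k
    have e3 : 1 / lam * (1 / lam ^ (n + 1 + 1)) = 1 / lam ^ (n + 1 + 1 + 1) := by
      field_simp
      ring
    linarith

theorem C1_norm_bound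
    (F : ℝ → ℝ) (hF : ContDiff ℝ 2 F)
    (w : ℕ) (hw : 0 < w) (hFw : ∀ x : ℝ, F (x + 1) = F x + w)
    (T : UnitAddCircle → UnitAddCircle) (hT : ∀ x : ℝ, T ↑x = (↑(F x) : UnitAddCircle))
    (lam : ℝ) (hlam : 1 < lam) (hexp : ∀ x : ℝ, lam ≤ deriv F x)
    (nT'' : ℝ) (hnT'' : nT'' = ⨆ x : ℝ, |deriv (deriv F) x|)
    (Omega : ℝ) (hOmega : Omega = nT'' / (lam * (lam - 1)))
    (T' : UnitAddCircle → ℝ) (hT'lift : ∀ x : ℝ, T' ↑x = deriv F x)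
    (L : (UnitAddCircle → ℝ) → (UnitAddCircle → ℝ))
    (hL : ∀ u : UnitAddCircle → ℝ, ∀ x : UnitAddCircle,
      L u x = ∑' y : (T ⁻¹' {x}), u y / T' y)
    (ψ : UnitAddCircle → ℝ) (hψ : ContDiff ℝ 1 (fun x : ℝ => ψ ↑x))
    (ψ' : UnitAddCircle → ℝ) (hψ' : ∀ x : ℝ, ψ' ↑x = deriv (fun y : ℝ => ψ ↑y) x) :
    ∀ n : ℕ, ContDiff ℝ 1 (fun x : ℝ => (L^[n] ψ) ↑x) ∧
      ∀ g : UnitAddCircle → ℝ, (∀ x : ℝ, g ↑x = deriv (fun y : ℝ => (L^[n] ψ) ↑y) x) →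
        ((⨆ x, |(L^[n] ψ) x|) + ⨆ x, |g x|) ≤
            (1 + Omega) ^ 2 * ((⨆ x, |ψ x|) + ⨆ x, |ψ' x|) ∧
          (1 ≤ n → ∀ x, |g x| ≤ (1 / lam ^ n) * (L^[n] (fun z => |ψ' z|)) x
            + nT'' * (∑ i ∈ Finset.Icc 2 (n + 1), (1 / lam ^ i))
              * (L^[n] (fun z => |ψ z|)) x) := by
  have hpos : ∀ x, 0 < deriv F x := fun x => by linarith [hexp x]
  have hl0 : 0 < lam := by linarith
  obtain ⟨G, h1, h2, hG, h3⟩ := aux_inv F hF w hw hFw lam hlam hexp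
  have hLs : ∀ (u : UnitAddCircle → ℝ) (x : ℝ),
      L u ↑x = ∑ j ∈ Finset.range w, u ↑(G (x + j)) / deriv F (G (x + j)) := by
    intro u x
    rw [hL, aux_sum F w hw T hT G h1 h2 h3 (fun y => u y / T' y) x]
    simp only [hT'lift]
  have hM : ∀ x, |deriv (deriv F) x| ≤ nT'' := by
    have hF1 : ContDiff ℝ 1 (deriv F) := by
      have : ContDiff ℝ (1 + 1) F := by norm_num; exact hF
      exact (contDiff_succ_iff_deriv.1 this).2.2
    have hF2 := contDiff_one_iff_deriv.1 hF1
    have p1 : Function.Periodic (deriv F) 1 := by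
      intro x
      rw [← deriv_comp_add_const, funext hFw, deriv_add_const]
    have p2 : Function.Periodic (fun x => |deriv (deriv F) x|) 1 := by
      intro x
      simp only
      rw [← deriv_comp_add_const, funext p1]
    have hc := (p2.compact_of_continuous one_ne_zero hF2.2.abs).bddAbove
    intro x
    rw [hnT'']
    exact le_ciSup hc x
  have hnT0 : 0 ≤ nT'' := (abs_nonneg _).trans (hM 0)
  have mono : ∀ u v : UnitAddCircle → ℝ, (∀ z, u z ≤ v z) → ∀ z, L u z ≤ L v z := by
    intro u v huv z
    induction z using QuotientAddGroup.induction_on with | H t => ?_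
    change L u (t : UnitAddCircle) ≤ L v (t : UnitAddCircle)
    rw [hLs, hLs]
    refine Finset.sum_le_sum fun j _ => ?_
    have := hpos (G (t + j))
    have := huv (G (t + j))
    gcongr
  have lin : ∀ (a b : ℝ) (u v : UnitAddCircle → ℝ) (z), L (fun z => a * u z + b * v z) z
      = a * L u z + b * L v z := by
    intro a b u v z
    induction z using QuotientAddGroup.induction_on with | H t => ?_
    change L _ (t : UnitAddCircle) = a * L u (t : UnitAddCircle) + b * L v (t : UnitAddCircle)
    rw [hLs, hLs, hLs, Finset.mul_sum, Finset.mul_sum, ← Finset.sum_add_distrib]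
    refine Finset.sum_congr rfl fun j _ => ?_
    ring
  have labs : ∀ (u : UnitAddCircle → ℝ) z, |L u z| ≤ L (fun z => |u z|) z := by
    intro u z
    rw [abs_le]
    constructor
    · have a := mono (fun z => -1 * |u z| + 0 * u z) u (fun z => by linarith [neg_abs_le (u z)]) z
      rw [lin] at a
      linarith
    · exact mono _ _ (fun z => le_abs_self _) z
  have monon : ∀ (n : ℕ) (u v : UnitAddCircle → ℝ), (∀ z, u z ≤ v z) →
      ∀ z, L^[n] u z ≤ L^[n] v z := by
    intro n
    induction n with
    | zero => intro u v h z; exact h z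
    | succ n ih =>
      intro u v h z
      rw [Function.iterate_succ_apply, Function.iterate_succ_apply]
      exact ih _ _ (mono u v h) z
  have labsn : ∀ (n : ℕ) (u : UnitAddCircle → ℝ) z, |L^[n] u z| ≤ L^[n] (fun z => |u z|) z := by
    intro n
    induction n with
    | zero => intro u z; exact le_rfl
    | succ n ih =>
      intro u z
      rw [Function.iterate_succ_apply', Function.iterate_succ_apply']
      exact (labs _ z).trans (mono _ _ (ih u) z)
  have hconst : ∀ (n : ℕ) (c : ℝ) z, L^[n] (fun _ => c) z = c * L^[n] (fun _ => 1) z := by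
    intro n c
    induction n with
    | zero => intro z; simp
    | succ n ih =>
      intro z
      rw [Function.iterate_succ_apply', Function.iterate_succ_apply', funext ih]
      have := lin c 0 (L^[n] (fun _ => 1)) (fun _ => 1) z
      simpa using this
  have step : ∀ u : UnitAddCircle → ℝ, ContDiff ℝ 1 (fun x : ℝ => u ↑x) →
      ContDiff ℝ 1 (fun x : ℝ => L u ↑x) ∧
      ∀ u' : UnitAddCircle → ℝ, (∀ x : ℝ, u' ↑x = deriv (fun y : ℝ => u ↑y) x) →
      ∀ x : ℝ, |deriv (fun x : ℝ => L u ↑x) x| ≤ 1 / lam * L (fun z => |u' z|) ↑x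
        + nT'' / lam ^ 2 * L (fun z => |u z|) ↑x := by
    intro u hu
    have := aux_step F hF w lam hlam hexp nT'' hM G hG _ hu
    simp only [hLs]
    refine ⟨this.1, fun u' hu' x => ?_⟩
    simp only [hu']
    exact this.2 x
  have lift : ∀ u : UnitAddCircle → ℝ, ∃ u' : UnitAddCircle → ℝ,
      ∀ x : ℝ, u' ↑x = deriv (fun y : ℝ => u ↑y) x := by
    intro u
    have p : Function.Periodic (deriv (fun y : ℝ => u ↑y)) 1 := by
      intro x
      rw [← deriv_comp_add_const]
      simp only [AddCircle.coe_add_period]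
    exact ⟨p.lift, fun x => p.lift_coe x⟩
  have main : ∀ (φ φ' : UnitAddCircle → ℝ), ContDiff ℝ 1 (fun x : ℝ => φ ↑x) →
      (∀ x : ℝ, φ' ↑x = deriv (fun y : ℝ => φ ↑y) x) → ∀ n : ℕ,
      ContDiff ℝ 1 (fun x : ℝ => (L^[n] φ) ↑x) ∧
      ∀ x : ℝ, |deriv (fun y : ℝ => (L^[n] φ) ↑y) x| ≤ (1 / lam ^ n) * (L^[n] (fun z => |φ' z|)) x
            + nT'' * (∑ i ∈ Finset.Icc 2 (n + 1), (1 / lam ^ i))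
              * (L^[n] (fun z => |φ z|)) x := by
    intro φ φ' hφ hφ' n
    induction n with
    | zero => exact ⟨hφ, fun x => by simp [hφ']⟩
    | succ n ih =>
      simp only [Function.iterate_succ_apply']
      have hs := step _ ih.1
      refine ⟨hs.1, fun x => ?_⟩
      obtain ⟨u', hu'⟩ := lift (L^[n] φ)
      have a := hs.2 u' hu' x
      have b : L (fun z => |u' z|) x ≤ _ := mono _ (fun z => (1 / lam ^ n) * (L^[n] (fun z => |φ' z|)) z
            + (nT'' * (∑ i ∈ Finset.Icc 2 (n + 1), (1 / lam ^ i)))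
              * (L^[n] (fun z => |φ z|)) z) (by
        intro z
        induction z using QuotientAddGroup.induction_on with | H t => ?_
        have := ih.2 t
        rw [← hu'] at this
        exact this) x
      rw [lin] at b
      have c : L (fun z => |L^[n] φ z|) x ≤ _ := mono _ _ (labsn n φ) x
      have hS : ∑ i ∈ Finset.Icc 2 (n + 1 + 1), (1 / lam ^ i) =
          1 / lam * ∑ i ∈ Finset.Icc 2 (n + 1), (1 / lam ^ i) + 1 / lam ^ 2 := aux_geom lam hl0 n
      rw [hS]
      set A := L (L^[n] (fun z => |φ' z|)) ↑x
      set B := L (L^[n] (fun z => |φ z|)) ↑x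
      refine a.trans ?_
      calc _ ≤ 1 / lam * (1 / lam ^ n * A + (nT'' * (∑ i ∈ Finset.Icc 2 (n + 1), (1 / lam ^ i))) * B)
            + nT'' / lam ^ 2 * B := by gcongr
        _ = _ := by rw [pow_succ]; field_simp; ring
  have hO : ∀ n : ℕ, nT'' * (∑ i ∈ Finset.Icc 2 (n + 1), (1 / lam ^ i)) ≤ Omega := by
    intro n
    have e : ∑ i ∈ Finset.Icc 2 (n + 1), (1 / lam ^ i) =
        (1 / (lam * (lam - 1))) * (1 - 1 / lam ^ n) := by
      have : lam - 1 ≠ 0 := by linarith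
      induction n with
      | zero => simp
      | succ n ih =>
        rw [Finset.sum_Icc_succ_top (by omega), ih]
        field_simp
        ring
    rw [e, hOmega, div_eq_mul_one_div nT'']
    have : 0 < lam - 1 := by linarith
    refine mul_le_mul_of_nonneg_left ?_ hnT0
    have e2 : 0 < 1 / lam ^ n := by positivity
    have e3 : 0 < 1 / (lam * (lam - 1)) := by positivity
    nlinarith
  have hO0 : 0 ≤ Omega := by
    have : 0 < lam - 1 := by linarith
    rw [hOmega]; positivity
  have hone : ∀ (n : ℕ) z, 0 ≤ L^[n] (fun _ => 1) z := by
    intro n z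
    have := labsn n (fun _ => 1) z
    simp only [abs_one] at this
    exact (abs_nonneg _).trans this
  have hsup : ∀ (n : ℕ) z, L^[n] (fun _ => 1) z ≤ 1 + Omega := by
    intro n z
    induction z using QuotientAddGroup.induction_on with | H t => ?_
    have hm := main (fun _ => 1) (fun _ => 0) contDiff_const (by simp)
    refine aux_sup (fun x : ℝ => L^[n] (fun _ => 1) ↑x) (hm n).1 ?_ ?_ Omega ?_ t
    · intro x; simp only [AddCircle.coe_add_period]
    · induction n with
      | zero => simp
      | succ n ih =>
        simp only [Function.iterate_succ_apply', hLs]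
        refine Eq.trans ?_ ih
        exact aux_integral F hF w lam hlam hexp G hG h3 (fun x : ℝ => L^[n] (fun _ => 1) ↑x)
          (hm n).1.continuous (fun x => by simp only [AddCircle.coe_add_period])
    · intro x
      have := (hm n).2 x
      simp only [abs_zero, abs_one] at this
      rw [hconst n 0] at this
      refine this.trans ?_
      have := mul_le_mul_of_nonneg_right (hO n) (hone n x)
      linarith
  have hLn : ∀ (n : ℕ) (u : UnitAddCircle → ℝ) (c : ℝ), 0 ≤ c → (∀ z, |u z| ≤ c) → ∀ z,
      L^[n] (fun z => |u z|) z ≤ (1 + Omega) * c := by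
    intro n u c hc hu z
    refine (monon n _ (fun _ => c) hu z).trans ?_
    rw [hconst, mul_comm]
    exact mul_le_mul_of_nonneg_right (hsup n z) hc
  intro n
  have hmn := main ψ ψ' hψ hψ' n
  refine ⟨hmn.1, fun g hg => ?_⟩
  have hgb : ∀ x, |g x| ≤ (1 / lam ^ n) * (L^[n] (fun z => |ψ' z|)) x
            + nT'' * (∑ i ∈ Finset.Icc 2 (n + 1), (1 / lam ^ i))
              * (L^[n] (fun z => |ψ z|)) x := by
    intro z
    induction z using QuotientAddGroup.induction_on with | H t => ?_
    have := hmn.2 t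
    rw [← hg] at this
    exact this
  refine ⟨?_, fun _ => hgb⟩
  have b0 : ∀ z, |ψ z| ≤ ⨆ x, |ψ x| := fun z => le_ciSup (aux_bdd ψ hψ.continuous) z
  have b1 : ∀ z, |ψ' z| ≤ ⨆ x, |ψ' x| := fun z => le_ciSup (aux_bdd ψ' (by
    simp only [hψ']; exact (contDiff_one_iff_deriv.1 hψ).2)) z
  set A := ⨆ x, |ψ x|
  set B := ⨆ x, |ψ' x|
  have hA : 0 ≤ A := (abs_nonneg _).trans (b0 0)
  have hB : 0 ≤ B := (abs_nonneg _).trans (b1 0)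
  have c0 : (⨆ x, |(L^[n] ψ) x|) ≤ (1 + Omega) * A :=
    ciSup_le fun z => (labsn n ψ z).trans (hLn n ψ A hA b0 z)
  have c1 : (⨆ x, |g x|) ≤ (1 + Omega) * B + Omega * ((1 + Omega) * A) := by
    refine ciSup_le fun z => (hgb z).trans ?_
    have d0 := hLn n ψ A hA b0 z
    have d1 := hLn n ψ' B hB b1 z
    have d2 : 0 ≤ (L^[n] (fun z => |ψ' z|)) z := (abs_nonneg _).trans (labsn n ψ' z)
    have d3 : 0 ≤ (L^[n] (fun z => |ψ z|)) z := (abs_nonneg _).trans (labsn n ψ z)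
    refine add_le_add ?_ (mul_le_mul (hO n) d0 d3 hO0)
    have : 1 / lam ^ n ≤ 1 := by
      rw [div_le_one (by positivity)]
      exact one_le_pow₀ hlam.le
    nlinarith
  have : 0 ≤ Omega * (1 + Omega) * B := by positivity
  nlinarith
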